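/- Let e be an oriented segment in ℝ^d and let u, v ∈ ℝ^d. Let u' be the point of e closest to u and v' the point of e closest to v, and suppose that u' appears after v' along the orientation of e. Then for any two points û, v̂ on e with û not after v̂ along the orientation of e, one has max(‖û − u‖, ‖v̂ − v‖) ≥ min over r ∈ e of max(‖r − u‖, ‖r − v‖); equivalently, the Fréchet distance between the segment ûv̂ and the segment uv is at least min_{r ∈ e} max(‖r − u‖, ‖r − v‖). -/

import Mathlib

open Set

noncomputable section

namespace Jaywalk

variable {d : ℕ}

/-- An orientation-preserving reparameterization of `[0,1]`: a continuous, strictly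
increasing bijection of `[0,1]` onto itself with `f 0 = 0` and `f 1 = 1`. -/
structure IsReparam (f : ℝ → ℝ) : Prop where
  contOn : ContinuousOn f (Icc 0 1)
  strictMonoOn : StrictMonoOn f (Icc 0 1)
  mapsTo : MapsTo f (Icc 0 1) (Icc 0 1)
  surjOn : SurjOn f (Icc 0 1) (Icc 0 1)
  map_zero : f 0 = 0
  map_one : f 1 = 1

/-- The width of a reparameterization `f` with respect to curves `X Y : [0,1] → ℝ^d`. -/
def frechetWidth (X Y : ℝ → EuclideanSpace ℝ (Fin d)) (f : ℝ → ℝ) : ℝ :=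
  ⨆ t : Icc (0:ℝ) 1, ‖X (f ↑t) - Y ↑t‖

/-- The Fréchet distance between two curves `X Y : [0,1] → ℝ^d`. -/
def frechetDist (X Y : ℝ → EuclideanSpace ℝ (Fin d)) : ℝ :=
  sInf {w | ∃ f, IsReparam f ∧ w = frechetWidth X Y f}

/-- The segment from `p` to `q`, as a curve `t ↦ (1-t)·p + t·q`. -/
def seg (p q : EuclideanSpace ℝ (Fin d)) : ℝ → EuclideanSpace ℝ (Fin d) :=
  fun t => (1 - t) • p + t • q

/-- The subcurve `Z[s,t]`, affinely reparameterized over `[0,1]`. -/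
def subcurve (Z : ℝ → EuclideanSpace ℝ (Fin d)) (s t : ℝ) : ℝ → EuclideanSpace ℝ (Fin d) :=
  fun τ => Z (s + τ * (t - s))

/-- Vertices extended to all of `ℕ` (clamped at `n`). -/
def vtx {n : ℕ} (v : Fin (n+1) → EuclideanSpace ℝ (Fin d)) (i : ℕ) :
    EuclideanSpace ℝ (Fin d) :=
  v ⟨min i n, Nat.lt_succ_of_le (min_le_right i n)⟩

/-- The uniformly parameterized polygonal curve through the vertices `v 0, …, v n`. -/
def polyCurve {n : ℕ} (v : Fin (n+1) → EuclideanSpace ℝ (Fin d)) :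
    ℝ → EuclideanSpace ℝ (Fin d) :=
  fun t =>
    (1 - (t * n - ⌊t * n⌋₊)) • vtx v ⌊t * n⌋₊ + (t * n - ⌊t * n⌋₊) • vtx v (⌊t * n⌋₊ + 1)

/-- Concatenation of two curves (sharing an endpoint). -/
def concat (A B : ℝ → EuclideanSpace ℝ (Fin d)) : ℝ → EuclideanSpace ℝ (Fin d) :=
  fun t => if t ≤ 1/2 then A (2 * t) else B (2 * t - 1)

/-- Concatenation of a finite list of curves. -/
def concatList : List (ℝ → EuclideanSpace ℝ (Fin d)) → ℝ → EuclideanSpace ℝ (Fin d)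
  | [] => fun _ => 0
  | [A] => A
  | A :: B :: rest => concat A (concatList (B :: rest))

/-- Given curves `X Y`, the price of the tunnel from `a` to `b` (points of `[0,1]²`):
the Fréchet distance between the subcurve `X[a.1, b.1]` and the segment from
`Y a.2` to `Y b.2`. -/
def tunnelPrice (X Y : ℝ → EuclideanSpace ℝ (Fin d)) (a b : ℝ × ℝ) : ℝ :=
  frechetDist (subcurve X a.1 b.1) (seg (Y a.2) (Y b.2))

open Classical in
/-- Indices of marked vertices in the greedy `μ`-simplification of the polygonal curve with
vertices `v 0, …, v n`:  start at vertex `0`; repeatedly jump to the first later vertex at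
distance at least `μ` from the current one; finally also mark the last vertex `n`
(the sequence stabilizes at `n`). -/
def simplIdx (v : ℕ → EuclideanSpace ℝ (Fin d)) (μ : ℝ) (n : ℕ) : ℕ → ℕ
  | 0 => 0
  | k+1 =>
    if h : ∃ j, simplIdx v μ n k < j ∧ j ≤ n ∧ μ ≤ ‖v j - v (simplIdx v μ n k)‖
    then Nat.find h
    else n

/-- The vertices of the `μ`-simplification (with the final vertex repeated). -/
def simplVerts {n : ℕ} (v : Fin (n+1) → EuclideanSpace ℝ (Fin d)) (μ : ℝ) :
    Fin (n+1) → EuclideanSpace ℝ (Fin d) :=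
  fun k => vtx v (simplIdx (vtx v) μ n k.val)

/-- The `μ`-simplification `simpl(X, μ)` of the polygonal curve with vertices
`v 0, …, v n`: the polygonal curve through the marked vertices, in order. -/
def simpl {n : ℕ} (v : Fin (n+1) → EuclideanSpace ℝ (Fin d)) (μ : ℝ) :
    ℝ → EuclideanSpace ℝ (Fin d) :=
  polyCurve (simplVerts v μ)

/-- `y` is the parameter of a vertex of a (uniformly parameterized) polygonal curve
with `n` edges. -/
def vertexParam (n : ℕ) (y : ℝ) : Prop := ∃ i : Fin (n+1), y = ((i : ℕ) : ℝ) / n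

/-- The shortcut curve of `Y` determined by the list of shortcut parameter pairs,
starting from parameter `a`. -/
def shortcutFrom (Y : ℝ → EuclideanSpace ℝ (Fin d)) :
    List (ℝ × ℝ) → ℝ → ℝ → EuclideanSpace ℝ (Fin d)
  | [], a => subcurve Y a 1
  | (y₁, y₂) :: rest, a =>
      concat (subcurve Y a y₁) (concat (seg (Y y₁) (Y y₂)) (shortcutFrom Y rest y₂))

/-- The shortcut parameter pairs form a nondecreasing sequence inside `[0,1]` and all
parameters are vertices of the polygonal curve with `n` edges. -/
def ValidShortcuts (n : ℕ) (L : List (ℝ × ℝ)) : Prop :=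
  List.Chain' (· ≤ ·) ((0:ℝ) :: (L.flatMap fun p => [p.1, p.2]) ++ [1]) ∧
  ∀ p ∈ L, vertexParam n p.1 ∧ vertexParam n p.2

/-- The directed vertex-restricted `k`-shortcut Fréchet distance between a curve `X` and the
polygonal curve with vertices `w 0, …, w n`: the infimum of the Fréchet distance between `X`
and any vertex-restricted shortcut curve of `polyCurve w` with at most `k` shortcuts. -/
def shortcutFrechetDist {n : ℕ} (X : ℝ → EuclideanSpace ℝ (Fin d))
    (w : Fin (n+1) → EuclideanSpace ℝ (Fin d)) (k : ℕ) : ℝ :=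
  sInf {r | ∃ L : List (ℝ × ℝ), L.length ≤ k ∧ ValidShortcuts n L ∧
    r = frechetDist X (shortcutFrom (polyCurve w) L 0)}

/-- The directed vertex-restricted shortcut Fréchet distance (unbounded number of
shortcuts). -/
def shortcutFrechetDistUnbounded {n : ℕ} (X : ℝ → EuclideanSpace ℝ (Fin d))
    (w : Fin (n+1) → EuclideanSpace ℝ (Fin d)) : ℝ :=
  sInf {r | ∃ L : List (ℝ × ℝ), ValidShortcuts n L ∧
    r = frechetDist X (shortcutFrom (polyCurve w) L 0)}

theorem seg_zero (p q : EuclideanSpace ℝ (Fin d)) : seg p q 0 = p := by simp [seg]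

theorem seg_one (p q : EuclideanSpace ℝ (Fin d)) : seg p q 1 = q := by simp [seg]

theorem continuous_seg (p q : EuclideanSpace ℝ (Fin d)) : Continuous (seg p q) := by
  unfold seg
  fun_prop

theorem convexOn_norm_seg_sub (a b w : EuclideanSpace ℝ (Fin d)) :
    ConvexOn ℝ (Icc 0 1) fun τ => ‖seg a b τ - w‖ := by
  refine ⟨convex_Icc 0 1, fun x _ y _ α β hα hβ hαβ => ?_⟩
  have h : seg a b (α • x + β • y) - w = α • (seg a b x - w) + β • (seg a b y - w) := by
    obtain rfl : α = 1 - β := by linarith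
    simp only [seg, smul_eq_mul]
    module
  calc ‖seg a b (α • x + β • y) - w‖
      = ‖α • (seg a b x - w) + β • (seg a b y - w)‖ := by rw [h]
    _ ≤ ‖α • (seg a b x - w)‖ + ‖β • (seg a b y - w)‖ := norm_add_le _ _
    _ = α • ‖seg a b x - w‖ + β • ‖seg a b y - w‖ := by
      simp [norm_smul, abs_of_nonneg hα, abs_of_nonneg hβ]

/-- A convex function with a minimum at `m` increases away from `m`. -/
theorem le_of_mem_uIcc_of_isMinOn {s : Set ℝ} {h : ℝ → ℝ} (hc : ConvexOn ℝ s h)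
    {m x y : ℝ} (hm : m ∈ s) (hy : y ∈ s) (hmin : IsMinOn h s m) (hx : x ∈ uIcc m y) :
    h x ≤ h y :=
  (hc.le_max_of_mem_segment hm hy (by rwa [segment_eq_uIcc])).trans
    (max_le (hmin hy) le_rfl)

theorem exists_max_le_of_convexOn {f g : ℝ → ℝ} {s : Set ℝ} (hf : ConvexOn ℝ s f)
    (hg : ConvexOn ℝ s g) {mf mg : ℝ} (hmf : mf ∈ s) (hmg : mg ∈ s)
    (hfmin : IsMinOn f s mf) (hgmin : IsMinOn g s mg) (hm : mg ≤ mf)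
    {x y : ℝ} (hx : x ∈ s) (hy : y ∈ s) (hxy : x ≤ y) :
    ∃ τ ∈ s, max (f τ) (g τ) ≤ max (f x) (g y) := by
  rcases le_total y mf with h | h
  · exact ⟨y, hy, max_le_max
      (le_of_mem_uIcc_of_isMinOn hf hmf hx hfmin (mem_uIcc.2 (Or.inr ⟨hxy, h⟩))) le_rfl⟩
  rcases le_total mg x with h' | h'
  · exact ⟨x, hx, max_le_max le_rfl
      (le_of_mem_uIcc_of_isMinOn hg hmg hy hgmin (mem_uIcc.2 (Or.inl ⟨h', hxy⟩)))⟩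
  · exact ⟨mf, hmf, max_le_max (hfmin hx)
      (le_of_mem_uIcc_of_isMinOn hg hmg hy hgmin (mem_uIcc.2 (Or.inl ⟨hm, h⟩)))⟩

theorem isReparam_id : IsReparam id where
  contOn := continuousOn_id
  strictMonoOn := strictMonoOn_id
  mapsTo := mapsTo_id _
  surjOn := surjOn_id _
  map_zero := rfl
  map_one := rfl

theorem norm_sub_le_frechetWidth {X Y : ℝ → EuclideanSpace ℝ (Fin d)}
    (hX : ContinuousOn X (Icc 0 1)) (hY : ContinuousOn Y (Icc 0 1)) {f : ℝ → ℝ}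
    (hf : IsReparam f) {t : ℝ} (ht : t ∈ Icc (0 : ℝ) 1) :
    ‖X (f t) - Y t‖ ≤ frechetWidth X Y f := by
  have hcont : ContinuousOn (fun t => ‖X (f t) - Y t‖) (Icc 0 1) :=
    ((hX.comp hf.contOn hf.mapsTo).sub hY).norm
  have hbdd : BddAbove (range fun t : Icc (0 : ℝ) 1 => ‖X (f ↑t) - Y ↑t‖) := by
    rw [← image_eq_range (fun t => ‖X (f t) - Y t‖)]
    exact isCompact_Icc.bddAbove_image hcont
  exact le_ciSup hbdd ⟨t, ht⟩

/-- The Fréchet distance is at least the distance between corresponding endpoints. -/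
theorem max_norm_endpoints_le_frechetDist {X Y : ℝ → EuclideanSpace ℝ (Fin d)}
    (hX : ContinuousOn X (Icc 0 1)) (hY : ContinuousOn Y (Icc 0 1)) :
    max ‖X 0 - Y 0‖ ‖X 1 - Y 1‖ ≤ frechetDist X Y := by
  refine le_csInf ⟨_, id, isReparam_id, rfl⟩ ?_
  rintro _ ⟨f, hf, rfl⟩
  have h0 := norm_sub_le_frechetWidth hX hY hf (t := 0) (by simp)
  have h1 := norm_sub_le_frechetWidth hX hY hf (t := 1) (by simp)
  rw [hf.map_zero] at h0
  rw [hf.map_one] at h1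
  exact max_le h0 h1

/-- Let `e` be the oriented segment from `a` to `b`, let `u' = seg a b su`
be the point of `e` closest to `u`, and `v' = seg a b sv` the point of `e` closest to `v`,
and suppose `u'` appears after `v'` along `e` (i.e. `sv ≤ su`). Then for any points
`û = seg a b sh` and `v̂ = seg a b th` on `e` with `û` not after `v̂` (i.e. `sh ≤ th`), the
quantity `max(‖û − u‖, ‖v̂ − v‖)` — which equals the Fréchet distance between the segment
`û v̂` and the segment `uv` — is at least `min_{r ∈ e} max(‖r − u‖, ‖r − v‖)`. -/
theorem min_max_dist_le_of_reversed_projections {d : ℕ}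
    (a b u v : EuclideanSpace ℝ (Fin d))
    (su sv : ℝ) (hsu : su ∈ Icc (0:ℝ) 1) (hsv : sv ∈ Icc (0:ℝ) 1)
    (hu' : ∀ τ ∈ Icc (0:ℝ) 1, ‖seg a b su - u‖ ≤ ‖seg a b τ - u‖)
    (hv' : ∀ τ ∈ Icc (0:ℝ) 1, ‖seg a b sv - v‖ ≤ ‖seg a b τ - v‖)
    (horder : sv ≤ su)
    (sh th : ℝ) (hsh : sh ∈ Icc (0:ℝ) 1) (hth : th ∈ Icc (0:ℝ) 1) (hshth : sh ≤ th) :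
    sInf {x | ∃ τ ∈ Icc (0:ℝ) 1, x = max ‖seg a b τ - u‖ ‖seg a b τ - v‖} ≤
        max ‖seg a b sh - u‖ ‖seg a b th - v‖ ∧
      sInf {x | ∃ τ ∈ Icc (0:ℝ) 1, x = max ‖seg a b τ - u‖ ‖seg a b τ - v‖} ≤
        frechetDist (seg (seg a b sh) (seg a b th)) (seg u v) := by
  have hmin : sInf {x | ∃ τ ∈ Icc (0:ℝ) 1, x = max ‖seg a b τ - u‖ ‖seg a b τ - v‖} ≤
      max ‖seg a b sh - u‖ ‖seg a b th - v‖ := by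
    obtain ⟨τ, hτ, hle⟩ := exists_max_le_of_convexOn (convexOn_norm_seg_sub a b u)
      (convexOn_norm_seg_sub a b v) hsu hsv hu' hv' horder hsh hth hshth
    refine csInf_le_of_le ⟨0, ?_⟩ ⟨τ, hτ, rfl⟩ hle
    rintro _ ⟨_, _, rfl⟩
    positivity
  refine ⟨hmin, hmin.trans ?_⟩
  simpa only [seg_zero, seg_one] using max_norm_endpoints_le_frechetDist
    (continuous_seg (seg a b sh) (seg a b th)).continuousOn (continuous_seg u v).continuousOn

end Jaywalk
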